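/- Let m : ℝ₊ → (0,∞) be a nonincreasing locally absolutely continuous function with ∫₀^∞ (1+a)³ m(a) da < ∞, let ζ₀ : ℝ₊ → ℝ be measurable with −m′(a)/m(a) ≤ ζ₀(a) ≤ ζ_max a.e., let β > 0, and set k(a) := β exp( −∫₀^a ζ₀(τ) dτ ). Let g : ℝ₊ → ℝ be measurable with |g(a)| ≤ c m(a) for some c > 0 and g ∈ L¹(ℝ₊, (1+a)² da), and define b(t) := −β ∫_t^∞ g(a−t) exp( −∫_{a−t}^a ζ₀(τ) dτ ) da. Let r ∈ L¹(ℝ₊) satisfy r + r ⋆ k = k a.e., set x := b − r ⋆ b, and define 𝔯₀(a,t) := x(t−a) exp( −∫₀^a ζ₀(ã) dã ) for t > a and 𝔯₀(a,t) := g(a−t) exp( −∫_{a−t}^a ζ₀(ã) dã ) for t ≤ a. Then: (i) x ∈ L¹(ℝ₊, (1+t)² dt) ∩ L^∞(ℝ₊); (ii) 𝔯₀ ∈ L¹(ℝ₊ × ℝ₊, (1+a) da dt); (iii) there exists c′ > 0 such that |𝔯₀(a,t)| ≤ c′ m(a) for all (a,t). -/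

import Mathlib

open MeasureTheory Real Set Filter




/-- The forcing term `b(t) := −β ∫_t^∞ g(a−t) exp(−∫_{a−t}^a ζ₀) da` of the Volterra equation
satisfied by the boundary trace of the initial layer. -/
noncomputable def bFun (β : ℝ) (ζ₀ g : ℝ → ℝ) (t : ℝ) : ℝ :=
  -β * ∫ a in Set.Ioi t, g (a - t) * Real.exp (-∫ s in (a - t)..a, ζ₀ s)

/-- The boundary trace `x := b − r ⋆ b` of the initial layer. -/
noncomputable def xFun (β : ℝ) (ζ₀ g r : ℝ → ℝ) (t : ℝ) : ℝ :=
  bFun β ζ₀ g t - ∫ τ in (0:ℝ)..t, r (t - τ) * bFun β ζ₀ g τ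

/-- The initial layer `𝔯₀`, given by Duhamel's principle along characteristics. -/
noncomputable def r0Fun (β : ℝ) (ζ₀ g r : ℝ → ℝ) (a t : ℝ) : ℝ :=
  if a < t then xFun β ζ₀ g r (t - a) * Real.exp (-∫ s in (0:ℝ)..a, ζ₀ s)
  else g (a - t) * Real.exp (-∫ s in (a - t)..a, ζ₀ s)

noncomputable def cv (f g : ℝ → ℝ) (x : ℝ) : ℝ := ∫ t, f t * g (x - t)

lemma cv_eq (f g : ℝ → ℝ) : cv f g = convolution f g (ContinuousLinearMap.mul ℝ ℝ) volume := rfl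

lemma cv_int {f g : ℝ → ℝ} (hf : Integrable f) (hg : Integrable g) : Integrable (cv f g) :=
  hf.integrable_convolution (ContinuousLinearMap.mul ℝ ℝ) hg

lemma cv_ex {f g : ℝ → ℝ} (hf : Integrable f) (hg : Integrable g) :
    ∀ᵐ x, Integrable (fun t => f t * g (x - t)) :=
  hf.ae_convolution_exists (ContinuousLinearMap.mul ℝ ℝ) hg

lemma cv_comm (f g : ℝ → ℝ) : cv f g = cv g f := by
  ext x
  simp only [cv]
  rw [← integral_sub_left_eq_self _ volume x]
  simp [mul_comm]

lemma cv_congr {f g f' g' : ℝ → ℝ} (h1 : f =ᵐ[volume] f') (h2 : g =ᵐ[volume] g') :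
    cv f g = cv f' g' :=
  convolution_congr (ContinuousLinearMap.mul ℝ ℝ) h1 h2

lemma cv_assoc {f g h : ℝ → ℝ} (hf : Integrable f) (hg : Integrable g) (hh : Integrable h) :
    cv (cv f g) h =ᵐ[volume] cv f (cv g h) := by
  have e := cv_ex hf.norm (cv_int hg.norm hh.norm)
  filter_upwards [e] with x hx
  exact convolution_assoc (ContinuousLinearMap.mul ℝ ℝ) (ContinuousLinearMap.mul ℝ ℝ)
    (ContinuousLinearMap.mul ℝ ℝ) (ContinuousLinearMap.mul ℝ ℝ) (fun a b c => mul_assoc a b c)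
    hf.aestronglyMeasurable hg.aestronglyMeasurable hh.aestronglyMeasurable
    (hf.ae_convolution_exists _ hg) (hg.norm.ae_convolution_exists _ hh.norm) hx

lemma cv_add {f g h : ℝ → ℝ} (hf : Integrable f) (hg : Integrable g) (hh : Integrable h) :
    cv f (fun t => g t + h t) =ᵐ[volume] fun t => cv f g t + cv f h t := by
  filter_upwards [cv_ex hf hg, cv_ex hf hh] with x h1 h2
  simp only [cv, mul_add]
  exact integral_add h1 h2

lemma cv_sub {f g h : ℝ → ℝ} (hf : Integrable f) (hg : Integrable g) (hh : Integrable h) :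
    cv f (fun t => g t - h t) =ᵐ[volume] fun t => cv f g t - cv f h t := by
  filter_upwards [cv_ex hf hg, cv_ex hf hh] with x h1 h2
  simp only [cv, mul_sub]
  exact integral_sub h1 h2

lemma cv_res {K R u : ℝ → ℝ} (hK : Integrable K) (hR : Integrable R) (hu : Integrable u)
    (hres : ∀ᵐ t, R t + cv R K t = K t) :
    ∀ᵐ t, cv R (cv K u) t = cv K u t - cv R u t := by
  have h1 : cv R K =ᵐ[volume] fun t => K t - R t := by
    filter_upwards [hres] with t ht
    linarith
  have h2 : cv (cv R K) u = cv u (fun t => K t - R t) := by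
    rw [cv_comm _ u]
    exact cv_congr (ae_eq_refl _) h1
  filter_upwards [cv_assoc hR hK hu, cv_sub hu hK hR] with t h3 h4
  rw [← h3, h2, h4, cv_comm u K, cv_comm u R]

lemma cv_key {K R y F : ℝ → ℝ} (hK : Integrable K) (hR : Integrable R) (hF : Integrable F)
    (hK0 : ∀ t ≤ 0, K t = 0) (hR0 : ∀ t ≤ 0, R t = 0)
    (hres : ∀ᵐ t, R t + cv R K t = K t)
    (hy : ∀ T : ℝ, Integrable (indicator (Iic T) y))
    (hyF : ∀ᵐ t, y t + cv K y t = F t) : Integrable y := by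
  have main : ∀ T : ℝ, ∀ᵐ t, t ≤ T → y t = F t - cv R F t := by
    intro T
    set yT := indicator (Iic T) y with hyT
    have hyTi : Integrable yT := hy T
    have hcK : ∀ t ≤ T, cv K yT t = cv K y t := by
      intro t ht
      simp only [cv]
      congr 1
      ext s
      rcases le_or_gt s 0 with hs | hs
      · simp [hK0 s hs]
      · have : t - s ∈ Iic T := by simp only [mem_Iic]; linarith
        rw [hyT, indicator_of_mem this]
    set G : ℝ → ℝ := fun t => yT t + cv K yT t with hG
    have hGi : Integrable G := hyTi.add (cv_int hK hyTi)
    have hGF : ∀ᵐ t, t ≤ T → G t = F t := by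
      filter_upwards [hyF] with t h ht
      have : t ∈ Iic T := ht
      rw [hG, ← h]
      simp only
      rw [hcK t ht, hyT, indicator_of_mem this]
    have hcR : ∀ t ≤ T, cv R G t = cv R F t := by
      intro t ht
      simp only [cv]
      apply integral_congr_ae
      have q := (quasiMeasurePreserving_sub_left_of_right_invariant volume t).ae hGF
      filter_upwards [q] with s hs
      rcases le_or_gt s 0 with h0 | h0
      · simp [hR0 s h0]
      · rw [hs (by linarith)]
    filter_upwards [hGF, cv_add hR hyTi (cv_int hK hyTi), cv_res hK hR hyTi hres]
      with t h1 h2 h3 ht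
    have h4 := hcR t ht
    have h5 := h1 ht
    have h6 : yT t = y t := indicator_of_mem (show t ∈ Iic T from ht) y
    rw [← h4, ← h5, h2, h3, hG, ← h6]
    ring
  have : ∀ᵐ t, y t = F t - cv R F t := by
    have h := ae_all_iff.2 (fun n : ℕ => main n)
    filter_upwards [h] with t ht
    obtain ⟨n, hn⟩ := exists_nat_ge t
    exact ht n hn
  exact (hF.sub (cv_int hR hF)).congr (by
    filter_upwards [this] with t ht
    simp [ht])

lemma cv_der {f g : ℝ → ℝ} (hf : Integrable f) (hf1 : Integrable (fun t => t * f t))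
    (hg : Integrable g) :
    ∀ᵐ x, x * cv f g x = cv (fun t => t * f t) g x + cv f (fun t => t * g t) x := by
  filter_upwards [cv_ex hf hg, cv_ex hf1 hg] with x h1 h2
  simp only [cv]
  have : (fun s => f s * ((x - s) * g (x - s)))
      = fun s => x * (f s * g (x - s)) - s * f s * g (x - s) := by
    ext s; ring
  rw [this, integral_sub (h1.const_mul x) h2, integral_const_mul]
  ring

lemma cv_step {K R y F : ℝ → ℝ} (hK : Integrable K) (hR : Integrable R) (hF1 : Integrable (fun t => t * F t))
    (hK1 : Integrable (fun t => t * K t)) (hyi : Integrable y)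
    (hK0 : ∀ t ≤ 0, K t = 0) (hR0 : ∀ t ≤ 0, R t = 0) (hy0 : ∀ t ≤ 0, y t = 0)
    (hres : ∀ᵐ t, R t + cv R K t = K t)
    (hyF : ∀ᵐ t, y t + cv K y t = F t) :
    Integrable (fun t => t * y t) ∧
    ∀ᵐ t, t * y t + cv K (fun t => t * y t) t = t * F t - cv (fun t => t * K t) y t := by
  have h1 : ∀ᵐ t, t * y t + cv K (fun t => t * y t) t
      = t * F t - cv (fun t => t * K t) y t := by
    filter_upwards [hyF, cv_der hK hK1 hyi] with t a b
    rw [← a, mul_add, b]; ring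
  refine ⟨cv_key hK hR (hF1.sub (cv_int hK1 hyi)) hK0 hR0 hres ?_ h1, h1⟩
  intro T
  refine (hyi.norm.const_mul |T|).mono' ?_ ?_
  · exact (AEStronglyMeasurable.mul (by fun_prop) hyi.aestronglyMeasurable).indicator measurableSet_Iic
  · filter_upwards with t
    by_cases ht : t ∈ Iic T
    · rw [indicator_of_mem ht, norm_mul]
      rcases le_or_gt t 0 with h | h
      · simp [hy0 t h]
      · gcongr
        rw [Real.norm_eq_abs]
        exact abs_le_abs_of_nonneg h.le ht
    · rw [indicator_of_notMem ht]
      simp only [norm_zero]; positivity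

lemma cv_final {K R X B : ℝ → ℝ} (hK : Integrable K) (hR : Integrable R)
    (hK1 : Integrable (fun t => t * K t)) (hK2 : Integrable (fun t => t * (t * K t)))
    (hB : Integrable B) (hB1 : Integrable (fun t => t * B t))
    (hB2 : Integrable (fun t => t * (t * B t)))
    (hK0 : ∀ t ≤ 0, K t = 0) (hR0 : ∀ t ≤ 0, R t = 0) (hX0 : ∀ t ≤ 0, X t = 0)
    (hres : ∀ᵐ t, R t + cv R K t = K t)
    (hX : ∀ t, X t = B t - cv R B t) :
    Integrable X ∧ Integrable (fun t => (1 + t) ^ 2 * X t) := by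
  have hXe : X = fun t => B t - cv R B t := funext hX
  have hXi : Integrable X := by rw [hXe]; exact hB.sub (cv_int hR hB)
  have hres' : ∀ᵐ t, cv K (cv R B) t = cv K B t - cv R B t := by
    have e : cv (cv K R) B = cv (cv R K) B := by rw [cv_comm K R]
    filter_upwards [cv_assoc hK hR hB, cv_assoc hR hK hB, cv_res hK hR hB hres] with t a b c
    rw [← a, e, b, c]
  have hXF : ∀ᵐ t, X t + cv K X t = B t := by
    filter_upwards [hres', cv_sub hK hB (cv_int hR hB)] with t a b
    rw [hXe]
    simp only
    rw [b, a]; ring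
  obtain ⟨i1, e1⟩ := cv_step hK hR hB1 hK1 hXi hK0 hR0 hX0 hres hXF
  have hF2 : Integrable (fun t => t * (t * B t - cv (fun t => t * K t) X t)) := by
    have := (cv_int hK2 hXi).add (cv_int hK1 i1)
    refine (hB2.sub this).congr ?_
    filter_upwards [cv_der hK1 hK2 hXi] with t a
    simp only [Pi.sub_apply, Pi.add_apply]
    rw [mul_sub, a]
  obtain ⟨i2, -⟩ := cv_step hK hR hF2 hK1 i1 hK0 hR0 (fun t ht => by simp [hX0 t ht]) hres e1
  refine ⟨hXi, ((hXi.add (i1.const_mul 2)).add i2).congr ?_⟩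
  filter_upwards with t
  simp only [Pi.add_apply]; ring

lemma wt {f φ : ℝ → ℝ} (hf0 : ∀ t ≤ 0, f t = 0) (hf : Integrable (fun t => (1 + t) ^ 2 * f t))
    (hφ : Measurable φ) (hb : ∀ t > 0, |φ t| ≤ (1 + t) ^ 2) : Integrable (fun t => φ t * f t) := by
  have := Integrable.bdd_mul (c := 1) (f := indicator (Ioi 0) (fun t => φ t / (1 + t) ^ 2)) hf
    ((Measurable.indicator (by fun_prop) measurableSet_Ioi).aestronglyMeasurable) ?_
  · refine this.congr ?_
    filter_upwards with t
    rcases le_or_gt t 0 with h | h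
    · simp [hf0 t h]
    · have : t ∈ Ioi (0:ℝ) := h
      rw [indicator_of_mem this]
      field_simp
  · filter_upwards with t
    rcases le_or_gt t 0 with h | h
    · rw [indicator_of_notMem (by simpa using h)]; simp
    · have : t ∈ Ioi (0:ℝ) := h
      rw [indicator_of_mem this, norm_div, Real.norm_eq_abs, Real.norm_eq_abs,
        abs_of_pos (a := (1 + t) ^ 2) (by positivity)]
      exact div_le_one_of_le₀ (hb t h) (by positivity)
lemma zeta_nn {m ζ₀ : ℝ → ℝ} {ζmax : ℝ} (hmpos : ∀ a, 0 ≤ a → 0 < m a)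
    (hmanti : AntitoneOn m (Set.Ici 0))
    (hζ : ∀ᵐ a ∂(volume.restrict (Set.Ioi (0:ℝ))),
      -(deriv m a) / m a ≤ ζ₀ a ∧ ζ₀ a ≤ ζmax) :
    ∀ᵐ a : ℝ, 0 < a → 0 ≤ -(deriv m a) / m a ∧ -(deriv m a) / m a ≤ ζ₀ a ∧ ζ₀ a ≤ ζmax := by
  rw [ae_restrict_iff' measurableSet_Ioi] at hζ
  filter_upwards [hζ] with a h ha
  refine ⟨div_nonneg ?_ (hmpos a ha.le).le, h ha⟩
  have : derivWithin m (Ici 0) a ≤ 0 := hmanti.derivWithin_nonpos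
  rw [derivWithin_of_mem_nhds (Ici_mem_nhds ha)] at this
  linarith

lemma zeta_ii {ζ₀ : ℝ → ℝ} {ζmax : ℝ} (hζmeas : Measurable ζ₀)
    (hz : ∀ᵐ a : ℝ, 0 < a → 0 ≤ ζ₀ a ∧ ζ₀ a ≤ ζmax) {s t : ℝ} (hs : 0 ≤ s) (hst : s ≤ t) :
    IntervalIntegrable ζ₀ volume s t := by
  rw [intervalIntegrable_iff_integrableOn_Ioc_of_le hst]
  refine Measure.integrableOn_of_bounded (M := ζmax) (by simp) hζmeas.aestronglyMeasurable ?_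
  rw [ae_restrict_iff' measurableSet_Ioc]
  filter_upwards [hz] with a h ha
  have := h (lt_of_le_of_lt hs ha.1)
  rw [Real.norm_eq_abs, abs_of_nonneg this.1]
  exact this.2

lemma exp_bd {m ζ₀ : ℝ → ℝ} {ζmax : ℝ} (hmpos : ∀ a, 0 ≤ a → 0 < m a)
    (hmdiff : DifferentiableOn ℝ m (Set.Ioi 0)) (hζmeas : Measurable ζ₀)
    (hz : ∀ᵐ a : ℝ, 0 < a → 0 ≤ -(deriv m a) / m a ∧ -(deriv m a) / m a ≤ ζ₀ a ∧ ζ₀ a ≤ ζmax)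
    {s t : ℝ} (hs : 0 < s) (hst : s ≤ t) :
    Real.exp (-∫ u in s..t, ζ₀ u) ≤ m t / m s := by
  have hd : ∀ x ∈ uIcc s t, HasDerivAt (fun u => Real.log (m u)) (deriv m x / m x) x := by
    intro x hx
    rw [uIcc_of_le hst] at hx
    have hx0 : 0 < x := lt_of_lt_of_le hs hx.1
    have := (hmdiff.differentiableAt (Ioi_mem_nhds hx0)).hasDerivAt
    exact this.log (hmpos x hx0.le).ne'
  have hmm : AEStronglyMeasurable m (volume.restrict (Ioc s t)) := by
    refine ContinuousOn.aestronglyMeasurable ?_ measurableSet_Ioc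
    exact hmdiff.continuousOn.mono (fun x hx => lt_trans hs hx.1)
  have hi : IntervalIntegrable (fun x => deriv m x / m x) volume s t := by
    rw [intervalIntegrable_iff_integrableOn_Ioc_of_le hst]
    refine Integrable.of_bound ?_ ζmax ?_
    · exact ((measurable_deriv m).aestronglyMeasurable.aemeasurable.div hmm.aemeasurable).aestronglyMeasurable
    · rw [ae_restrict_iff' measurableSet_Ioc]
      filter_upwards [hz] with a h ha
      have := h (lt_trans hs ha.1)
      rw [neg_div] at this
      rw [Real.norm_eq_abs, abs_of_nonpos (by linarith [this.1])]
      linarith [this.2]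
  have key := intervalIntegral.integral_eq_sub_of_hasDerivAt hd hi
  have hle : ∫ u in s..t, -(deriv m u / m u) ≤ ∫ u in s..t, ζ₀ u := by
    refine intervalIntegral.integral_mono_ae_restrict hst hi.neg ?_ ?_
    · exact zeta_ii hζmeas (by
        filter_upwards [hz] with a h ha
        exact ⟨(h ha).1.trans (h ha).2.1, (h ha).2.2⟩) hs.le hst
    · rw [EventuallyLE, ae_restrict_iff' measurableSet_Icc]
      filter_upwards [hz] with a h ha
      have := (h (lt_of_lt_of_le hs ha.1)).2.1
      rwa [neg_div] at this
  rw [intervalIntegral.integral_neg, key] at hle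
  have p1 := hmpos s hs.le
  have p2 := hmpos t (hs.le.trans hst)
  calc Real.exp (-∫ u in s..t, ζ₀ u) ≤ Real.exp (Real.log (m t) - Real.log (m s)) :=
        Real.exp_le_exp.2 (by linarith)
    _ = m t / m s := by rw [Real.exp_sub, Real.exp_log p1, Real.exp_log p2]

lemma exp_bd0 {m ζ₀ : ℝ → ℝ} {ζmax : ℝ} (hmpos : ∀ a, 0 ≤ a → 0 < m a)
    (hmanti : AntitoneOn m (Set.Ici 0))
    (hmdiff : DifferentiableOn ℝ m (Set.Ioi 0)) (hζmeas : Measurable ζ₀)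
    (hz : ∀ᵐ a : ℝ, 0 < a → 0 ≤ -(deriv m a) / m a ∧ -(deriv m a) / m a ≤ ζ₀ a ∧ ζ₀ a ≤ ζmax)
    {t : ℝ} (ht : 0 ≤ t) :
    Real.exp (-∫ u in (0:ℝ)..t, ζ₀ u) ≤ m t / m 1 := by
  have hz' : ∀ᵐ a : ℝ, 0 < a → 0 ≤ ζ₀ a ∧ ζ₀ a ≤ ζmax := by
    filter_upwards [hz] with a h ha
    exact ⟨(h ha).1.trans (h ha).2.1, (h ha).2.2⟩
  have nn : ∀ {b : ℝ}, 0 ≤ b → 0 ≤ ∫ u in (0:ℝ)..b, ζ₀ u := by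
    intro b hb
    rw [intervalIntegral.integral_of_le hb]
    refine setIntegral_nonneg_of_ae_restrict ?_
    rw [EventuallyLE, ae_restrict_iff' measurableSet_Ioc]
    filter_upwards [hz'] with a h ha
    exact (h ha.1).1
  have p1 := hmpos 1 zero_le_one
  rcases le_total t 1 with h | h
  · calc Real.exp (-∫ u in (0:ℝ)..t, ζ₀ u) ≤ 1 := Real.exp_le_one_iff.2 (by linarith [nn ht])
      _ ≤ m t / m 1 := by
        rw [one_le_div p1]
        exact hmanti ht (zero_le_one' ℝ) h
  · refine le_trans (Real.exp_le_exp.2 ?_) (exp_bd hmpos hmdiff hζmeas hz one_pos h)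
    have := intervalIntegral.integral_add_adjacent_intervals
      (zeta_ii hζmeas hz' le_rfl (zero_le_one' ℝ)) (zeta_ii hζmeas hz' (zero_le_one' ℝ) h)
    linarith [nn (zero_le_one' ℝ)]

lemma dom {m ζ₀ g : ℝ → ℝ} {ζmax c : ℝ} (hmpos : ∀ a, 0 ≤ a → 0 < m a)
    (hmanti : AntitoneOn m (Set.Ici 0))
    (hmdiff : DifferentiableOn ℝ m (Set.Ioi 0)) (hζmeas : Measurable ζ₀)
    (hz : ∀ᵐ a : ℝ, 0 < a → 0 ≤ -(deriv m a) / m a ∧ -(deriv m a) / m a ≤ ζ₀ a ∧ ζ₀ a ≤ ζmax)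
    (hc : 0 < c) (hgm : ∀ a, 0 ≤ a → |g a| ≤ c * m a) :
    ∃ D > 0, (∀ s a, 0 ≤ s → s ≤ a → |g s * Real.exp (-∫ u in s..a, ζ₀ u)| ≤ D * m a) ∧
      ∀ a, 0 ≤ a → Real.exp (-∫ u in (0:ℝ)..a, ζ₀ u) ≤ D * m a := by
  have p1 := hmpos 1 zero_le_one
  have p0 := hmpos 0 le_rfl
  refine ⟨c + c * m 0 / m 1 + 1 / m 1, by positivity, ?_, ?_⟩
  · intro s a hs hsa
    have pa := hmpos a (hs.trans hsa)
    rw [abs_mul, Real.abs_exp]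
    rcases hs.eq_or_lt with rfl | h
    · calc |g 0| * Real.exp (-∫ u in (0:ℝ)..a, ζ₀ u) ≤ (c * m 0) * (m a / m 1) :=
            mul_le_mul (hgm 0 le_rfl) (exp_bd0 hmpos hmanti hmdiff hζmeas hz hsa)
              (Real.exp_pos _).le (by positivity)
        _ = (0 + c * m 0 / m 1 + 0) * m a := by ring
        _ ≤ _ := by gcongr <;> positivity
    · have ps := hmpos s hs
      calc |g s| * Real.exp (-∫ u in s..a, ζ₀ u) ≤ (c * m s) * (m a / m s) :=
            mul_le_mul (hgm s hs) (exp_bd hmpos hmdiff hζmeas hz h hsa)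
              (Real.exp_pos _).le (by positivity)
        _ = c * m a := by field_simp
        _ ≤ _ := by
          gcongr
          have : 0 < c * m 0 / m 1 := by positivity
          have : 0 < 1 / m 1 := by positivity
          linarith
  · intro a ha
    have pa := hmpos a ha
    refine (exp_bd0 hmpos hmanti hmdiff hζmeas hz ha).trans ?_
    calc m a / m 1 = (0 + 0 + 1 / m 1) * m a := by ring
      _ ≤ _ := by gcongr <;> positivity
lemma P_int {M : ℝ → ℝ} (hM : Integrable M) (hM1 : Integrable (fun a => a * M a)) :
    Integrable (fun p : ℝ × ℝ => indicator {p : ℝ × ℝ | 0 < p.1 ∧ p.1 ≤ p.2} (fun p => M p.2) p)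
      (volume.prod volume) := by
  have hS : MeasurableSet {p : ℝ × ℝ | 0 < p.1 ∧ p.1 ≤ p.2} :=
    (measurableSet_lt measurable_const measurable_fst).inter
      (measurableSet_le measurable_fst measurable_snd)
  have hms : AEStronglyMeasurable (fun p : ℝ × ℝ =>
      indicator {p : ℝ × ℝ | 0 < p.1 ∧ p.1 ≤ p.2} (fun p => M p.2) p)
      (volume.prod volume) := hM.aestronglyMeasurable.comp_snd.indicator hS
  have e : ∀ a t : ℝ, indicator {p : ℝ × ℝ | 0 < p.1 ∧ p.1 ≤ p.2} (fun p => M p.2) (t, a)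
      = indicator (Ioc 0 a) (fun _ => M a) t := fun a t => rfl
  rw [integrable_prod_iff' hms]
  constructor
  · filter_upwards with a
    simp only [e]
    rw [integrable_indicator_iff measurableSet_Ioc]
    simp
  · refine (hM1.norm.indicator (measurableSet_Ioi (a := (0:ℝ)))).congr ?_
    filter_upwards with a
    simp only [e, norm_indicator_eq_indicator_norm]
    rw [integral_indicator measurableSet_Ioc]
    rcases le_or_gt a 0 with h | h
    · rw [indicator_of_notMem (by simpa using h)]
      simp [h]
    · rw [indicator_of_mem (show a ∈ Ioi (0:ℝ) from h)]
      simp [h.le, abs_of_pos h]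
/-- Properties of the initial layer `𝔯₀` of the linkage density (Proposition 4.3 of the
paper): (i) its boundary trace `x = b − r ⋆ b` belongs to `L¹(ℝ₊,(1+t)²dt) ∩ L^∞(ℝ₊)`,
(ii) the layer itself is in `L¹(ℝ₊×ℝ₊,(1+a) da dt)` and (iii) is dominated by `m`. -/
theorem stmt14
    (m : ℝ → ℝ) (hmpos : ∀ a, 0 ≤ a → 0 < m a) (hmanti : AntitoneOn m (Set.Ici 0))
    (hmdiff : DifferentiableOn ℝ m (Set.Ioi 0))
    (hmint : IntegrableOn (fun a => (1 + a) ^ 3 * m a) (Set.Ioi 0))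
    (ζ₀ : ℝ → ℝ) (hζmeas : Measurable ζ₀) (ζmax : ℝ)
    (hζ : ∀ᵐ a ∂(volume.restrict (Set.Ioi (0:ℝ))),
      -(deriv m a) / m a ≤ ζ₀ a ∧ ζ₀ a ≤ ζmax)
    (β : ℝ) (hβ : 0 < β)
    (g : ℝ → ℝ) (hgmeas : Measurable g) (c : ℝ) (hc : 0 < c)
    (hgm : ∀ a, 0 ≤ a → |g a| ≤ c * m a)
    (hgint : IntegrableOn (fun a => (1 + a) ^ 2 * g a) (Set.Ioi 0))
    (r : ℝ → ℝ) (hrint : IntegrableOn r (Set.Ioi 0))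
    (hres : ∀ᵐ t ∂(volume.restrict (Set.Ioi (0:ℝ))),
      r t + (∫ τ in (0:ℝ)..t,
          r (t - τ) * (β * Real.exp (-∫ s in (0:ℝ)..τ, ζ₀ s)))
        = β * Real.exp (-∫ s in (0:ℝ)..t, ζ₀ s)) :
    (IntegrableOn (fun t => (1 + t) ^ 2 * xFun β ζ₀ g r t) (Set.Ioi 0) ∧
      ∃ Cx : ℝ, ∀ t, 0 ≤ t → |xFun β ζ₀ g r t| ≤ Cx) ∧
    IntegrableOn (fun p : ℝ × ℝ => (1 + p.1) * r0Fun β ζ₀ g r p.1 p.2)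
      (Set.Ioi (0:ℝ) ×ˢ Set.Ioi (0:ℝ)) ∧
    ∃ c' : ℝ, 0 < c' ∧ ∀ a, 0 ≤ a → ∀ t, 0 ≤ t → |r0Fun β ζ₀ g r a t| ≤ c' * m a := by
  have hz := zeta_nn hmpos hmanti hζ
  have hz' : ∀ᵐ a : ℝ, 0 < a → 0 ≤ ζ₀ a ∧ ζ₀ a ≤ ζmax := by
    filter_upwards [hz] with a h ha
    exact ⟨(h ha).1.trans (h ha).2.1, (h ha).2.2⟩
  obtain ⟨D, hD, hD1, hD2⟩ := dom hmpos hmanti hmdiff hζmeas hz hc hgm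
  -- primitive
  set Z : ℝ → ℝ := fun a => ∫ s in (0:ℝ)..a, indicator (Ioi 0) ζ₀ s with hZ
  have hzi : ∀ a b : ℝ, IntervalIntegrable (indicator (Ioi 0) ζ₀) volume a b := by
    intro a b
    rw [intervalIntegrable_iff, uIoc]
    refine Integrable.of_bound ((hζmeas.indicator measurableSet_Ioi).aestronglyMeasurable) |ζmax| ?_
    refine ae_restrict_of_ae ?_
    filter_upwards [hz'] with x hx
    rcases le_or_gt x 0 with h | h
    · rw [indicator_of_notMem (by simpa using h)]; simp
    · rw [indicator_of_mem (show x ∈ Ioi (0:ℝ) from h), Real.norm_eq_abs]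
      exact abs_le_abs_of_nonneg (hx h).1 (hx h).2
  have hZc : Continuous Z := intervalIntegral.continuous_primitive hzi 0
  have hZe : ∀ s a : ℝ, 0 ≤ s → s ≤ a → ∫ u in s..a, ζ₀ u = Z a - Z s := by
    intro s a hs hsa
    rw [hZ]
    simp only
    rw [intervalIntegral.integral_interval_sub_left (hzi _ _) (hzi _ _)]
    refine intervalIntegral.integral_congr_ae ?_
    filter_upwards with x hx
    rw [uIoc_of_le hsa] at hx
    rw [indicator_of_mem (show x ∈ Ioi (0:ℝ) from lt_of_le_of_lt hs hx.1)]
  have hZ0 : Z 0 = 0 := by simp [hZ]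
  -- weighted integrability of `m`
  set M0 : ℝ → ℝ := fun a => (1 + a) * indicator (Ioi 0) m a with hM0
  have hM00 : ∀ t ≤ 0, M0 t = 0 := by
    intro t ht
    simp only [hM0]
    rw [indicator_of_notMem (by simpa using ht), mul_zero]
  have hM0i : Integrable (fun t => (1 + t) ^ 2 * M0 t) := by
    rw [← integrable_indicator_iff measurableSet_Ioi] at hmint
    refine hmint.congr ?_
    filter_upwards with t
    by_cases h : t ∈ Ioi (0:ℝ)
    · simp only [hM0, indicator_of_mem h]; ring
    · simp only [hM0, indicator_of_notMem h]; ring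
  have hmi : ∀ φ : ℝ → ℝ, Measurable φ → (∀ t > 0, |φ t| ≤ (1 + t) ^ 2) →
      Integrable (fun t => φ t * M0 t) := fun φ h1 h2 => wt hM00 hM0i h1 h2
  -- the second branch
  set S : Set (ℝ × ℝ) := {p : ℝ × ℝ | 0 < p.1 ∧ p.1 ≤ p.2} with hS
  have hSm : MeasurableSet S :=
    (measurableSet_lt measurable_const measurable_fst).inter
      (measurableSet_le measurable_fst measurable_snd)
  set G : ℝ × ℝ → ℝ := indicator S (fun p => g (p.2 - p.1) *
    Real.exp (-(Z p.2 - Z (p.2 - p.1)))) with hG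
  have hGm : Measurable G := by
    refine Measurable.indicator ?_ hSm
    have : Measurable Z := hZc.measurable
    fun_prop
  have hGe : ∀ t a, 0 < t → t ≤ a →
      G (t, a) = g (a - t) * Real.exp (-∫ s in (a - t)..a, ζ₀ s) := by
    intro t a h1 h2
    rw [hG, indicator_of_mem (show (t, a) ∈ S from ⟨h1, h2⟩),
      hZe (a - t) a (by linarith) (by linarith)]
  have hGb : ∀ t a, 0 < t → t ≤ a → |G (t, a)| ≤ D * m a := by
    intro t a h1 h2
    rw [hGe t a h1 h2]
    exact hD1 (a - t) a (by linarith) (by linarith)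
  have hGi : ∀ φ : ℝ × ℝ → ℝ, Measurable φ → (∀ t a, 0 < t → t ≤ a → |φ (t, a)| ≤ (1 + a) ^ 2) →
      Integrable (fun p => φ p * G p) (volume.prod volume) := by
    intro φ h1 h2
    have hP := (P_int (M := fun a => (1 + a) * M0 a)
      (hmi _ (by fun_prop) (fun t ht => by rw [abs_of_pos (by linarith)]; nlinarith))
      ((hmi (fun a => a * (1 + a)) (by fun_prop) (fun t ht => by
        rw [abs_of_pos (by positivity)]; nlinarith)).congr
          (by filter_upwards with a; ring))).const_mul D
    refine hP.mono' (h1.mul hGm).aestronglyMeasurable ?_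
    filter_upwards with p
    obtain ⟨t, a⟩ := p
    by_cases h : (t, a) ∈ S
    · rw [indicator_of_mem h, norm_mul, Real.norm_eq_abs, Real.norm_eq_abs]
      have ha : 0 < a := lt_of_lt_of_le h.1 h.2
      simp only [hM0]
      rw [indicator_of_mem (show a ∈ Ioi (0:ℝ) from ha)]
      calc |φ (t, a)| * |G (t, a)| ≤ (1 + a) ^ 2 * (D * m a) :=
            mul_le_mul (h2 t a h.1 h.2) (hGb t a h.1 h.2) (abs_nonneg _) (by positivity)
        _ = _ := by ring
    · rw [hG]
      rw [indicator_of_notMem h, show {p : ℝ × ℝ | 0 < p.1 ∧ p.1 ≤ p.2} = S from rfl,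
        indicator_of_notMem h]
      simp
  -- the forcing term
  set b := bFun β ζ₀ g with hb
  have hbe : ∀ t, 0 < t → b t = -β * ∫ a, G (t, a) := by
    intro t ht
    simp only [hb, bFun]
    congr 1
    rw [← integral_Ici_eq_integral_Ioi, ← integral_indicator measurableSet_Ici]
    congr 1
    ext a
    by_cases h : a ∈ Ici t
    · rw [indicator_of_mem h, hGe t a ht h]
    · rw [indicator_of_notMem h, hG, indicator_of_notMem]
      exact fun h' => h h'.2
  set B : ℝ → ℝ := indicator (Ioi 0) b with hB
  have hB0 : ∀ t ≤ 0, B t = 0 := fun t ht => indicator_of_notMem (by simpa using ht) _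
  have hBi : Integrable (fun t => (1 + t) ^ 2 * B t) := by
    have h1 := (hGi (fun p => (1 + p.1) ^ 2) (by fun_prop) (fun t a h1 h2 => by
      rw [abs_of_pos (by positivity)]; gcongr)).integral_prod_left.const_mul (-β)
    refine h1.congr ?_
    filter_upwards with t
    rcases le_or_gt t 0 with h | h
    · rw [hB0 t h]
      have : ∀ a, G (t, a) = 0 := fun a => indicator_of_notMem (fun h' => absurd h'.1 (not_lt.2 h)) _
      simp [this]
    · rw [hB, indicator_of_mem (show t ∈ Ioi (0:ℝ) from h), hbe t h]
      simp only [integral_const_mul]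
      ring
  have hmi0 : IntegrableOn m (Ioi 0) := by
    rw [← integrable_indicator_iff measurableSet_Ioi]
    refine (hmi (fun a => if 0 < a then (1 + a)⁻¹ else 0)
      (Measurable.ite measurableSet_Ioi (by fun_prop) (by fun_prop)) ?_).congr ?_
    · intro t ht
      rw [if_pos ht, abs_of_pos (by positivity)]
      have : (1 + t)⁻¹ ≤ 1 := inv_le_one_of_one_le₀ (by linarith)
      nlinarith
    · filter_upwards with t
      rcases le_or_gt t 0 with h | h
      · rw [hM00 t h, indicator_of_notMem (by simpa using h), mul_zero]
      · simp only [if_pos h, hM0]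
        field_simp
  obtain ⟨Cb, hCb0, hCb⟩ : ∃ Cb, 0 ≤ Cb ∧ ∀ t, 0 ≤ t → |b t| ≤ Cb := by
    refine ⟨β * ∫ a in Ioi 0, D * m a, ?_, ?_⟩
    · refine mul_nonneg hβ.le (setIntegral_nonneg measurableSet_Ioi fun a ha => ?_)
      exact mul_nonneg hD.le (hmpos a (le_of_lt ha)).le
    · intro t ht
      simp only [hb, bFun]
      rw [abs_mul, abs_neg, abs_of_pos hβ]
      gcongr
      have hsub : Ioi t ⊆ Ioi (0:ℝ) := Ioi_subset_Ioi ht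
      have hmD : IntegrableOn (fun a => D * m a) (Ioi 0) := hmi0.const_mul D
      calc |∫ a in Ioi t, g (a - t) * Real.exp (-∫ s in (a - t)..a, ζ₀ s)|
          ≤ ∫ a in Ioi t, D * m a := by
            rw [← Real.norm_eq_abs]
            refine norm_integral_le_of_norm_le (hmD.mono_set hsub) ?_
            rw [ae_restrict_iff' measurableSet_Ioi]
            filter_upwards with a ha
            have : t < a := ha
            exact hD1 (a - t) a (by linarith) (by linarith)
        _ ≤ ∫ a in Ioi 0, D * m a := by
            refine setIntegral_mono_set hmD ?_ hsub.eventuallyLE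
            rw [EventuallyLE, ae_restrict_iff' measurableSet_Ioi]
            filter_upwards with a ha
            exact mul_nonneg hD.le (hmpos a (le_of_lt ha)).le
  -- kernels
  set k : ℝ → ℝ := fun a => β * Real.exp (-∫ s in (0:ℝ)..a, ζ₀ s) with hk
  set K : ℝ → ℝ := indicator (Ioi 0) k with hKd
  set R : ℝ → ℝ := indicator (Ioi 0) r with hRd
  have hK0 : ∀ t ≤ 0, K t = 0 := fun t ht => indicator_of_notMem (by simpa using ht) _
  have hR0 : ∀ t ≤ 0, R t = 0 := fun t ht => indicator_of_notMem (by simpa using ht) _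
  have hRi : Integrable R := (integrable_indicator_iff measurableSet_Ioi).2 hrint
  have hKm : Measurable K := by
    have : K = indicator (Ioi 0) (fun a => β * Real.exp (-Z a)) := by
      ext a
      by_cases h : a ∈ Ioi (0:ℝ)
      · have h' : 0 < a := h
        rw [hKd, indicator_of_mem h, indicator_of_mem h, hk]
        simp only
        rw [hZe 0 a le_rfl h'.le, hZ0, sub_zero]
      · rw [hKd, indicator_of_notMem h, indicator_of_notMem h]
    rw [this]
    have : Measurable Z := hZc.measurable
    exact Measurable.indicator (by fun_prop) measurableSet_Ioi
  have hKi3 : Integrable (fun t => (1 + t) ^ 2 * K t) := by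
    refine (hM0i.const_mul (β * D)).mono' (by fun_prop) ?_
    filter_upwards with t
    rcases le_or_gt t 0 with h | h
    · simp [hK0 t h, hM00 t h]
    · have ht : t ∈ Ioi (0:ℝ) := h
      have := hD2 t h.le
      have pm := hmpos t h.le
      rw [hKd, hM0, indicator_of_mem ht]
      simp only
      rw [indicator_of_mem ht, hk, Real.norm_eq_abs, abs_of_pos (by positivity)]
      calc (1 + t) ^ 2 * (β * Real.exp (-∫ s in (0:ℝ)..t, ζ₀ s))
          ≤ (1 + t) ^ 2 * (β * (D * m t)) := by gcongr
        _ ≤ (1 + t) * ((1 + t) ^ 2 * (β * (D * m t))) :=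
          le_mul_of_one_le_left (by positivity) (by linarith)
        _ = _ := by ring
  have w0 : ∀ f : ℝ → ℝ, (∀ t ≤ 0, f t = 0) → Integrable (fun t => (1 + t) ^ 2 * f t) →
      Integrable f ∧ Integrable (fun t => t * f t) ∧ Integrable (fun t => t * (t * f t)) := by
    intro f h0 h1
    refine ⟨?_, ?_, ?_⟩
    · simpa using wt (φ := fun _ => 1) h0 h1 (by fun_prop) (fun t ht => by
        rw [abs_one]; nlinarith)
    · exact wt (φ := fun t => t) h0 h1 (by fun_prop) (fun t ht => by
        rw [abs_of_pos ht]; nlinarith)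
    · refine (wt (φ := fun t => t * t) h0 h1 (by fun_prop) (fun t ht => by
        rw [abs_of_pos (by positivity)]; nlinarith)).congr ?_
      filter_upwards with t
      ring
  obtain ⟨hKi, hK1, hK2⟩ := w0 K hK0 hKi3
  obtain ⟨hBi0, hB1, hB2⟩ := w0 B hB0 hBi
  have pc : ∀ f h : ℝ → ℝ, ∀ t, cv (indicator (Ioi 0) h) (indicator (Ioi 0) f) t
      = indicator (Ioi 0) (fun t => ∫ τ in (0:ℝ)..t, h (t - τ) * f τ) t := by
    intro f h t
    rw [cv_comm, cv_eq, ← posConvolution_eq_convolution_indicator f h (ContinuousLinearMap.mul ℝ ℝ) volume]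
    simp only [posConvolution, ContinuousLinearMap.mul_apply']
    simp only [mul_comm]
  have hres' : ∀ᵐ t, R t + cv R K t = K t := by
    rw [ae_restrict_iff' measurableSet_Ioi] at hres
    filter_upwards [hres] with t ht
    rw [pc]
    by_cases h : t ∈ Ioi (0:ℝ)
    · rw [hRd, hKd, indicator_of_mem h, indicator_of_mem h, indicator_of_mem h]
      exact ht h
    · rw [hRd, hKd, indicator_of_notMem h, indicator_of_notMem h, indicator_of_notMem h, add_zero]
  set x := xFun β ζ₀ g r with hx
  set X : ℝ → ℝ := indicator (Ioi 0) x with hXd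
  have hX0 : ∀ t ≤ 0, X t = 0 := fun t ht => indicator_of_notMem (by simpa using ht) _
  have hX : ∀ t, X t = B t - cv R B t := by
    intro t
    rw [pc]
    by_cases h : t ∈ Ioi (0:ℝ)
    · rw [hXd, hB, indicator_of_mem h, indicator_of_mem h, indicator_of_mem h]
      rfl
    · rw [hXd, hB, indicator_of_notMem h, indicator_of_notMem h, indicator_of_notMem h, sub_zero]
  obtain ⟨hXi, hXi2⟩ := cv_final hKi hRi hK1 hK2 hBi0 hB1 hB2 hK0 hR0 hX0 hres' hX
  obtain ⟨Cx, hCx0, hCx⟩ : ∃ Cx, 0 ≤ Cx ∧ ∀ t, 0 ≤ t → |x t| ≤ Cx := by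
    refine ⟨Cb + (∫ s, |R s|) * Cb, ?_, ?_⟩
    · have : 0 ≤ ∫ s, |R s| := integral_nonneg fun s => abs_nonneg _
      positivity
    · intro t ht
      have h1 : |∫ τ in (0:ℝ)..t, r (t - τ) * b τ| ≤ (∫ s, |R s|) * Cb := by
        have hi : Integrable (fun τ => |R (t - τ)| * Cb) :=
          (hRi.abs.comp_sub_left t).mul_const Cb
        calc |∫ τ in (0:ℝ)..t, r (t - τ) * b τ| ≤ ∫ τ in (0:ℝ)..t, |R (t - τ)| * Cb := by
              rw [← Real.norm_eq_abs]
              refine intervalIntegral.norm_integral_le_of_norm_le ht ?_ hi.intervalIntegrable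
              have : ∀ᵐ τ : ℝ, τ ≠ t := by simp [ae_iff]
              filter_upwards [this] with τ hne hτ
              have hm : t - τ ∈ Ioi (0:ℝ) := by
                have := lt_of_le_of_ne hτ.2 hne
                simp only [mem_Ioi]; linarith
              rw [hRd, indicator_of_mem hm, norm_mul, Real.norm_eq_abs, Real.norm_eq_abs]
              gcongr
              exact hCb τ hτ.1.le
          _ ≤ ∫ τ, |R (t - τ)| * Cb := by
              rw [intervalIntegral.integral_of_le ht]
              exact setIntegral_le_integral hi (by
                filter_upwards with τ
                exact mul_nonneg (abs_nonneg _) hCb0)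
          _ = (∫ s, |R s|) * Cb := by
              rw [integral_mul_const, integral_sub_left_eq_self (fun s => |R s|) volume t]
      have h2 : x t = b t - ∫ τ in (0:ℝ)..t, r (t - τ) * b τ := rfl
      rw [h2]
      exact (abs_sub _ _).trans (add_le_add (hCb t ht) h1)
  refine ⟨⟨?_, Cx, hCx⟩, ?_, ?_⟩
  · rw [← integrable_indicator_iff measurableSet_Ioi]
    refine hXi2.congr ?_
    filter_upwards with t
    by_cases h : t ∈ Ioi (0:ℝ)
    · rw [hXd, indicator_of_mem h, indicator_of_mem h]
    · rw [hXd, indicator_of_notMem h, indicator_of_notMem h, mul_zero]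
  · have hq : MeasurableSet (Ioi (0:ℝ) ×ˢ Ioi (0:ℝ)) := measurableSet_Ioi.prod measurableSet_Ioi
    have hK4 : Integrable (fun a => (1 + a) * K a) :=
      (hKi.add hK1).congr (by filter_upwards with a; simp only [Pi.add_apply]; ring)
    have i1 : Integrable (fun p : ℝ × ℝ => β⁻¹ * (((1 + p.1) * K p.1) * X (p.2 - p.1)))
        (volume.prod volume) :=
      ((hK4.convolution_integrand (ContinuousLinearMap.mul ℝ ℝ) hXi).swap).const_mul β⁻¹
    have i2 : Integrable (fun p : ℝ × ℝ => (1 + p.1) * G (p.2, p.1)) (volume.prod volume) :=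
      (hGi (fun p => 1 + p.2) (by fun_prop) (fun t a h1 h2 => by
        rw [abs_of_pos (by linarith)]; nlinarith)).swap
    have i3 := (i1.add i2).integrableOn (s := Ioi (0:ℝ) ×ˢ Ioi (0:ℝ))
    refine i3.congr_fun ?_ hq
    rintro ⟨a, t⟩ ⟨ha, ht⟩
    have ha' : 0 < a := ha
    have ht' : 0 < t := ht
    simp only [Pi.add_apply, r0Fun]
    split_ifs with h
    · have e1 : G (t, a) = 0 := indicator_of_notMem (fun h' => absurd h'.2 (not_le.2 h)) _
      have hta : t - a ∈ Ioi (0:ℝ) := by simp only [mem_Ioi]; linarith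
      rw [e1, hXd, hKd, indicator_of_mem hta, indicator_of_mem ha, hk]
      field_simp
      ring
    · rw [hX0 (t - a) (by linarith), hGe t a ht' (by linarith)]
      ring
  · refine ⟨Cx * D + D, by positivity, ?_⟩
    intro a ha t ht
    have pm := hmpos a ha
    unfold r0Fun
    split_ifs with h
    · rw [abs_mul, Real.abs_exp]
      calc |xFun β ζ₀ g r (t - a)| * Real.exp (-∫ s in (0:ℝ)..a, ζ₀ s) ≤ Cx * (D * m a) :=
            mul_le_mul (hCx _ (by linarith)) (hD2 a ha) (Real.exp_pos _).le hCx0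
        _ ≤ _ := by
            have : 0 < D * m a := by positivity
            linarith
    · refine (hD1 (a - t) a (by linarith) (by linarith)).trans ?_
      gcongr
      have : 0 ≤ Cx * D := by positivity
      linarith
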